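/- arXiv:1607.00997 — 3 statements merged into one kernel-verified Lean document; each statement's English description precedes it below -/
import Mathlib

section
/- Let k be a field with char k ∉ {2,3}. Let F ∈ k[X,Y,Z] be a homogeneous cubic polynomial with F(X,Y,0) = XY² − X³. Then there exist unique elements b, c, p₂, p₄, q₄, p₆ ∈ k such that F(X + bZ, Y + cZ, Z) = XY² + 2q₄YZ² − X³ − p₂X²Z − p₄XZ² − p₆Z³. -/
open MvPolynomial

/-- The general ternary cubic form. -/
noncomputable def cubicForm {k : Type*} [Field k] (a : Fin 10 → k) : MvPolynomial (Fin 3) k :=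
  C (a 0) * (X 0 ^ 3 * X 1 ^ 0 * X 2 ^ 0) + C (a 1) * (X 0 ^ 2 * X 1 ^ 1 * X 2 ^ 0)
  + C (a 2) * (X 0 ^ 1 * X 1 ^ 2 * X 2 ^ 0) + C (a 3) * (X 0 ^ 0 * X 1 ^ 3 * X 2 ^ 0)
  + C (a 4) * (X 0 ^ 2 * X 1 ^ 0 * X 2 ^ 1) + C (a 5) * (X 0 ^ 1 * X 1 ^ 1 * X 2 ^ 1)
  + C (a 6) * (X 0 ^ 0 * X 1 ^ 2 * X 2 ^ 1) + C (a 7) * (X 0 ^ 1 * X 1 ^ 0 * X 2 ^ 2)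
  + C (a 8) * (X 0 ^ 0 * X 1 ^ 1 * X 2 ^ 2) + C (a 9) * (X 0 ^ 0 * X 1 ^ 0 * X 2 ^ 3)

theorem cubic_monomial {k : Type*} [Field k] (d : Fin 3 →₀ ℕ) (c : k) :
    monomial d c = C c * (X 0 ^ d 0 * X 1 ^ d 1 * X 2 ^ d 2) := by
  rw [monomial_eq, Finsupp.prod_fintype _ _ (by simp), Fin.prod_univ_three]

theorem cubic_coeff {k : Type*} [Field k] (i j l i' j' l' : ℕ) (c : k) :
    coeff (Finsupp.equivFunOnFinite.symm ![i', j', l'])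
      (C c * (X 0 ^ i * X 1 ^ j * X 2 ^ l) : MvPolynomial (Fin 3) k)
      = if i = i' ∧ j = j' ∧ l = l' then c else 0 := by
  have h := cubic_monomial (Finsupp.equivFunOnFinite.symm ![i, j, l]) c
  simp only [Finsupp.equivFunOnFinite_symm_apply_apply, Matrix.cons_val] at h
  rw [← h, coeff_monomial]
  simp [Matrix.vecCons_inj]

theorem cubicForm_inj {k : Type*} [Field k] {a b : Fin 10 → k}
    (h : cubicForm a = cubicForm b) : a = b := by
  have key := fun i j l : ℕ => congrArg (coeff (Finsupp.equivFunOnFinite.symm ![i, j, l])) h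
  simp only [cubicForm, coeff_add, cubic_coeff] at key
  funext n
  fin_cases n
  · simpa using key 3 0 0
  · simpa using key 2 1 0
  · simpa using key 1 2 0
  · simpa using key 0 3 0
  · simpa using key 2 0 1
  · simpa using key 1 1 1
  · simpa using key 0 2 1
  · simpa using key 1 0 2
  · simpa using key 0 1 2
  · simpa using key 0 0 3

set_option maxHeartbeats 2000000 in
theorem cubicForm_exists {k : Type*} [Field k] (F : MvPolynomial (Fin 3) k)
    (hF : F.IsHomogeneous 3) : ∃ a, F = cubicForm a := by
  rw [F.as_sum]
  refine Finset.sum_induction _ (fun G => ∃ a, G = cubicForm a) ?_ ?_ ?_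
  · rintro _ _ ⟨a, rfl⟩ ⟨b, rfl⟩
    exact ⟨a + b, by simp only [cubicForm, Pi.add_apply, C_add]; ring⟩
  · exact ⟨0, by simp [cubicForm]⟩
  · intro d hd
    have h := hF (mem_support_iff.mp hd)
    rw [Finsupp.weight_apply, Finsupp.sum_fintype _ _ (by simp), Fin.sum_univ_three] at h
    simp only [Pi.one_apply, smul_eq_mul, mul_one] at h
    rw [cubic_monomial]
    generalize coeff d F = c
    generalize d 0 = i at *
    generalize d 1 = j at *
    generalize d 2 = l at *
    have hij : (i = 3 ∧ j = 0 ∧ l = 0) ∨ (i = 2 ∧ j = 1 ∧ l = 0) ∨ (i = 1 ∧ j = 2 ∧ l = 0)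
        ∨ (i = 0 ∧ j = 3 ∧ l = 0) ∨ (i = 2 ∧ j = 0 ∧ l = 1) ∨ (i = 1 ∧ j = 1 ∧ l = 1)
        ∨ (i = 0 ∧ j = 2 ∧ l = 1) ∨ (i = 1 ∧ j = 0 ∧ l = 2) ∨ (i = 0 ∧ j = 1 ∧ l = 2)
        ∨ (i = 0 ∧ j = 0 ∧ l = 3) := by omega
    rcases hij with h | h | h | h | h | h | h | h | h | h <;> obtain ⟨rfl, rfl, rfl⟩ := h
    · exact ⟨Pi.single 0 c, by simp [cubicForm, Pi.single_apply]⟩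
    · exact ⟨Pi.single 1 c, by simp [cubicForm, Pi.single_apply]⟩
    · exact ⟨Pi.single 2 c, by simp [cubicForm, Pi.single_apply]⟩
    · exact ⟨Pi.single 3 c, by simp [cubicForm, Pi.single_apply]⟩
    · exact ⟨Pi.single 4 c, by simp [cubicForm, Pi.single_apply]⟩
    · exact ⟨Pi.single 5 c, by simp [cubicForm, Pi.single_apply]⟩
    · exact ⟨Pi.single 6 c, by simp [cubicForm, Pi.single_apply]⟩
    · exact ⟨Pi.single 7 c, by simp [cubicForm, Pi.single_apply]⟩
    · exact ⟨Pi.single 8 c, by simp [cubicForm, Pi.single_apply]⟩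
    · exact ⟨Pi.single 9 c, by simp [cubicForm, Pi.single_apply]⟩

/-- any homogeneous cubic `F(X,Y,Z)` with `F(X,Y,0) = XY² − X³` can be put,
by a unique substitution `X ↦ X + bZ`, `Y ↦ Y + cZ`, into the standard form
`XY² + 2q₄YZ² − X³ − p₂X²Z − p₄XZ² − p₆Z³` for unique `b, c, p₂, p₄, q₄, p₆ ∈ k`. -/
theorem stmt1 (k : Type*) [Field k] (h2 : ringChar k ≠ 2) (h3 : ringChar k ≠ 3)
    (F : MvPolynomial (Fin 3) k)
    (hhom : F.IsHomogeneous 3)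
    (hinf : MvPolynomial.bind₁ (![X 0, X 1, 0] : Fin 3 → MvPolynomial (Fin 3) k) F
      = X 0 * X 1 ^ 2 - X 0 ^ 3) :
    ∃! t : k × k × k × k × k × k,
      MvPolynomial.bind₁
          (![X 0 + MvPolynomial.C t.1 * X 2, X 1 + MvPolynomial.C t.2.1 * X 2, X 2] :
            Fin 3 → MvPolynomial (Fin 3) k) F
        = X 0 * X 1 ^ 2 + MvPolynomial.C (2 * t.2.2.2.2.1) * X 1 * X 2 ^ 2 - X 0 ^ 3
          - MvPolynomial.C t.2.2.1 * X 0 ^ 2 * X 2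
          - MvPolynomial.C t.2.2.2.1 * X 0 * X 2 ^ 2
          - MvPolynomial.C t.2.2.2.2.2 * X 2 ^ 3 := by
  have two : (2 : k) ≠ 0 := Ring.two_ne_zero h2
  obtain ⟨a, rfl⟩ := cubicForm_exists F hhom
  have e1 : cubicForm ![a 0, a 1, a 2, a 3, 0, 0, 0, 0, 0, 0]
      = cubicForm ![(-1 : k), 0, 1, 0, 0, 0, 0, 0, 0, 0] := by
    simp [cubicForm] at hinf
    simp [cubicForm]
    linear_combination hinf
  have e2 := cubicForm_inj e1
  have a0 : a 0 = -1 := congrFun e2 0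
  have a1 : a 1 = 0 := congrFun e2 1
  have a2 : a 2 = 1 := congrFun e2 2
  have a3 : a 3 = 0 := congrFun e2 3
  have main : ∀ t : k × k × k × k × k × k, (MvPolynomial.bind₁
          (![X 0 + MvPolynomial.C t.1 * X 2, X 1 + MvPolynomial.C t.2.1 * X 2, X 2] :
            Fin 3 → MvPolynomial (Fin 3) k) (cubicForm a)
        = X 0 * X 1 ^ 2 + MvPolynomial.C (2 * t.2.2.2.2.1) * X 1 * X 2 ^ 2 - X 0 ^ 3
          - MvPolynomial.C t.2.2.1 * X 0 ^ 2 * X 2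
          - MvPolynomial.C t.2.2.2.1 * X 0 * X 2 ^ 2
          - MvPolynomial.C t.2.2.2.2.2 * X 2 ^ 3) ↔
      (![-1, 0, 1, 0, a 4 - 3 * t.1, a 5 + 2 * t.2.1, a 6 + t.1,
        a 7 + 2 * a 4 * t.1 + a 5 * t.2.1 + t.2.1 ^ 2 - 3 * t.1 ^ 2,
        a 8 + a 5 * t.1 + 2 * a 6 * t.2.1 + 2 * t.1 * t.2.1,
        a 9 + a 7 * t.1 + a 8 * t.2.1 + a 4 * t.1 ^ 2 + a 5 * t.1 * t.2.1 + a 6 * t.2.1 ^ 2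
          + t.1 * t.2.1 ^ 2 - t.1 ^ 3] : Fin 10 → k)
      = ![-1, 0, 1, 0, -t.2.2.1, 0, 0, -t.2.2.2.1, 2 * t.2.2.2.2.1, -t.2.2.2.2.2] := by
    rintro ⟨b, c, p2, p4, q4, p6⟩
    have C2 : (C 2 : MvPolynomial (Fin 3) k) = 2 := map_ofNat C 2
    have C3 : (C 3 : MvPolynomial (Fin 3) k) = 3 := map_ofNat C 3
    rw [← (show Function.Injective (cubicForm (k := k)) from fun _ _ => cubicForm_inj).eq_iff]
    refine Eq.congr ?_ ?_
    · simp [cubicForm, a0, a1, a2, a3, C2, C3]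
      ring
    · simp [cubicForm, C2]
      ring
  simp only [main]
  refine ⟨(-a 6, -a 5 / 2, -(a 4 - 3 * (-a 6)),
    -(a 7 + 2 * a 4 * (-a 6) + a 5 * (-a 5 / 2) + (-a 5 / 2) ^ 2 - 3 * (-a 6) ^ 2),
    (a 8 + a 5 * (-a 6) + 2 * a 6 * (-a 5 / 2) + 2 * (-a 6) * (-a 5 / 2)) / 2,
    -(a 9 + a 7 * (-a 6) + a 8 * (-a 5 / 2) + a 4 * (-a 6) ^ 2 + a 5 * (-a 6) * (-a 5 / 2)
      + a 6 * (-a 5 / 2) ^ 2 + (-a 6) * (-a 5 / 2) ^ 2 - (-a 6) ^ 3)), ?_, ?_⟩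
  · funext n
    fin_cases n <;> simp <;> field_simp <;> ring
  · rintro ⟨b, c, p2, p4, q4, p6⟩ h
    have f4 : a 4 - 3 * b = -p2 := congrFun h 4
    have f5 : a 5 + 2 * c = 0 := congrFun h 5
    have f6 : a 6 + b = 0 := congrFun h 6
    have f7 : a 7 + 2 * a 4 * b + a 5 * c + c ^ 2 - 3 * b ^ 2 = -p4 := congrFun h 7
    have f8 : a 8 + a 5 * b + 2 * a 6 * c + 2 * b * c = 2 * q4 := congrFun h 8
    have f9 : a 9 + a 7 * b + a 8 * c + a 4 * b ^ 2 + a 5 * b * c + a 6 * c ^ 2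
          + b * c ^ 2 - b ^ 3 = -p6 := congrFun h 9
    have hb : -a 6 = b := by linear_combination -f6
    have hc : -a 5 / 2 = c := by field_simp; linear_combination -f5
    rw [hb, hc, f4, f7, f8, f9]
    simp [two]
end

section
/- Let k be a field with char k ∉ {2,3}, let v ∈ V, and write v = Σ_ε v_ε with v_ε ∈ V_ε. Suppose there exist indices 1 ≤ i < j ≤ 4 such that v_ε = 0 for every ε ∈ {±1}⁴ with εᵢ = εⱼ = +1. Then the quartic polynomial g_v has a repeated root in an algebraic closure of k (equivalently, the discriminant of g_v vanishes, i.e. Δ(v) = 0). -/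
open Matrix

noncomputable section

variable (k : Type*) [Field k]

/-- The 8×8 matrix `Ψ`, block diagonal with two anti-diagonal 4×4 blocks. -/
def Psi : Matrix (Fin 8) (Fin 8) k :=
  !![0,0,0,1,0,0,0,0;
     0,0,1,0,0,0,0,0;
     0,1,0,0,0,0,0,0;
     1,0,0,0,0,0,0,0;
     0,0,0,0,0,0,0,1;
     0,0,0,0,0,0,1,0;
     0,0,0,0,0,1,0,0;
     0,0,0,0,1,0,0,0]

/-- The matrix `s = diag(1,−1,−1,1,1,−1,−1,1)`. -/
def sMat : Matrix (Fin 8) (Fin 8) k := Matrix.diagonal ![1,-1,-1,1,1,-1,-1,1]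

/-- The `(−1)`-eigenspace `V` of `θ(v) = svs` on `so₈(k)`. -/
def VSet : Set (Matrix (Fin 8) (Fin 8) k) :=
  {v | vᵀ * Psi k = -(Psi k * v) ∧ sMat k * v * sMat k = -v}

/-- `V` as a `k`-submodule of the 8×8 matrices. -/
def VSubm : Submodule k (Matrix (Fin 8) (Fin 8) k) where
  carrier := VSet k
  add_mem' := by
    intro a b ha hb
    obtain ⟨ha1, ha2⟩ := ha
    obtain ⟨hb1, hb2⟩ := hb
    constructor
    · rw [Matrix.transpose_add, Matrix.add_mul, ha1, hb1, Matrix.mul_add, neg_add]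
    · rw [Matrix.mul_add, Matrix.add_mul, ha2, hb2, neg_add]
  zero_mem' := by constructor <;> simp
  smul_mem' := by
    intro c a ha
    obtain ⟨ha1, ha2⟩ := ha
    constructor
    · rw [Matrix.transpose_smul, Matrix.smul_mul, ha1, Matrix.mul_smul, smul_neg]
    · rw [Matrix.mul_smul, Matrix.smul_mul, ha2, smul_neg]

/-- The diagonal torus element `D(a,b,c,d) = diag(a, b, b⁻¹, a⁻¹, c, d, d⁻¹, c⁻¹)`. -/
def Dm (a b c d : k) : Matrix (Fin 8) (Fin 8) k :=
  Matrix.diagonal ![a, b, b⁻¹, a⁻¹, c, d, d⁻¹, c⁻¹]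

/-- The character `χ_ε` (a sign pattern `ε ∈ {±1}⁴` is encoded by a `Bool` 4-tuple,
with `true` standing for `+1`). -/
def chi (ε : Fin 4 → Bool) (a b c d : k) : k :=
  (if ε 0 then (if ε 1 then a else c) else (if ε 1 then c⁻¹ else a⁻¹)) *
  (if ε 2 then (if ε 3 then b else d) else (if ε 3 then d⁻¹ else b⁻¹))

/-- The weight space `V_ε = {v ∈ V : D(a,b,c,d) v D(a,b,c,d)⁻¹ = χ_ε(a,b,c,d) v}`,
as a `k`-submodule of the 8×8 matrices. -/
def Veps (ε : Fin 4 → Bool) : Submodule k (Matrix (Fin 8) (Fin 8) k) where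
  carrier := {v | v ∈ VSet k ∧ ∀ a b c d : k, a ≠ 0 → b ≠ 0 → c ≠ 0 → d ≠ 0 →
    Dm k a b c d * v * Dm k a⁻¹ b⁻¹ c⁻¹ d⁻¹ = chi k ε a b c d • v}
  add_mem' := by
    intro x y ⟨hx, hx'⟩ ⟨hy, hy'⟩
    refine ⟨(VSubm k).add_mem hx hy, ?_⟩
    intro a b c d ha hb hc hd
    rw [Matrix.mul_add, Matrix.add_mul, hx' a b c d ha hb hc hd,
      hy' a b c d ha hb hc hd, smul_add]
  zero_mem' := by
    refine ⟨(VSubm k).zero_mem, ?_⟩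
    intro a b c d _ _ _ _
    simp
  smul_mem' := by
    intro t x ⟨hx, hx'⟩
    refine ⟨(VSubm k).smul_mem t hx, ?_⟩
    intro a b c d ha hb hc hd
    rw [Matrix.mul_smul, Matrix.smul_mul, hx' a b c d ha hb hc hd, smul_comm]

lemma aux_blk {R : Type*} [CommRing R] (N : Matrix (Fin 4 ⊕ Fin 4) (Fin 4 ⊕ Fin 4) R)
    (S c A b T : Matrix (Fin 4) (Fin 4) R)
    (h : N * fromBlocks S 0 c 1 = fromBlocks A b 0 T) : N.det * S.det = A.det * T.det := by
  have h3 := congrArg Matrix.det h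
  rwa [Matrix.det_mul, Matrix.det_fromBlocks_zero₁₂, Matrix.det_fromBlocks_zero₂₁,
    Matrix.det_one, mul_one] at h3

open Matrix Polynomial in
lemma aux_charpoly {k : Type*} [Field k] (B C : Matrix (Fin 4) (Fin 4) k) :
    (fromBlocks 0 B C 0).charpoly = (B * C).charpoly.comp (X ^ 2) := by
  have h1 : (B * C).charpoly.comp (X ^ 2) =
      (Matrix.scalar (Fin 4) ((X : k[X]) ^ 2) - (B * C).map Polynomial.C).det := by
    rw [Matrix.charpoly, ← Polynomial.coe_compRingHom_apply, RingHom.map_det]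
    congr 1
    ext i j
    by_cases h : i = j
    · subst h; simp [charmatrix, -Matrix.map_mul]
    · simp [charmatrix, h, -Matrix.map_mul]
  have h2 : (fromBlocks 0 B C 0).charmatrix *
      fromBlocks (Matrix.scalar (Fin 4) (X : k[X])) 0 (C.map Polynomial.C) 1 =
      fromBlocks (Matrix.scalar (Fin 4) ((X : k[X]) ^ 2) - (B * C).map Polynomial.C)
        (-(B.map Polynomial.C)) 0 (Matrix.scalar (Fin 4) (X : k[X])) := by
    rw [Matrix.charmatrix_fromBlocks, Matrix.fromBlocks_multiply]
    have e0 : (0 : Matrix (Fin 4) (Fin 4) k).charmatrix = Matrix.scalar (Fin 4) (X : k[X]) := by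
      simp [charmatrix]
    rw [e0]
    congr 1
    · rw [Matrix.map_mul, pow_two, map_mul, neg_mul, sub_eq_add_neg]
    · simp
    · rw [neg_mul, Matrix.scalar_comm _ (fun r => Commute.all _ _)]; simp [-Matrix.scalar_apply]
    · simp
  have h3 := aux_blk _ _ _ _ _ _ h2
  rw [h1, Matrix.charpoly]
  refine mul_right_cancel₀ ?_ h3
  simp [Matrix.scalar_apply, Matrix.det_diagonal]

open Matrix Polynomial in
lemma aux_sing {k : Type*} [Field k] (M : Matrix (Fin 4) (Fin 4) k)
    (hr : ∀ j, M 0 j = 0) (hc : ∀ i, M i 2 = 0) : X ^ 2 ∣ M.charpoly := by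
  rw [Matrix.charpoly]
  simp only [Matrix.det_succ_row_zero, Fin.sum_univ_succ, charmatrix_apply]
  simp [hr, hc, Fin.succAbove, Fin.lt_def, Matrix.diagonal_apply]
  exact ⟨C (M 1 1) * C (M 3 3) - C (M 1 3) * C (M 3 1) - X * C (M 1 1) - X * C (M 3 3) + X ^ 2,
    by ring⟩

open Matrix Polynomial in
lemma aux_sq {k : Type*} [Field k] (M : Matrix (Fin 4) (Fin 4) k)
    (h02 : M 0 2 = 0) (h03 : M 0 3 = 0) (h12 : M 1 2 = 0) (h13 : M 1 3 = 0)
    (h22 : M 2 2 = M 0 0) (h23 : M 2 3 = M 1 0) (h32 : M 3 2 = M 0 1) (h33 : M 3 3 = M 1 1) :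
    M.charpoly = ((X - C (M 0 0)) * (X - C (M 1 1)) - C (M 0 1) * C (M 1 0)) ^ 2 := by
  rw [Matrix.charpoly]
  simp only [Matrix.det_succ_row_zero, Fin.sum_univ_succ, charmatrix_apply]
  simp [h02, h03, h12, h13, h22, h23, h32, h33, Fin.succAbove, Fin.lt_def, Matrix.diagonal_apply]
  ring

open Matrix Polynomial in
lemma aux_root {k : Type*} [Field k] (g h : k[X]) (hh : h.degree ≠ 0) (hg : g ≠ 0)
    (hd : h ^ 2 ∣ g) : ∃ r : AlgebraicClosure k,
      2 ≤ (g.map (algebraMap k (AlgebraicClosure k))).rootMultiplicity r := by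
  obtain ⟨r, hr⟩ := IsAlgClosed.exists_root (h.map (algebraMap k (AlgebraicClosure k)))
    (by rwa [Polynomial.degree_map])
  refine ⟨r, ?_⟩
  rw [Polynomial.le_rootMultiplicity_iff (Polynomial.map_ne_zero hg)]
  refine (pow_dvd_pow_of_dvd (Polynomial.dvd_iff_isRoot.mpr hr) 2).trans ?_
  rw [← Polynomial.map_pow]
  exact Polynomial.map_dvd _ hd

open Matrix Polynomial in
lemma aux_main {k : Type*} [Field k] (v : Matrix (Fin 8) (Fin 8) k)
    (E O : Fin 4 → Fin 8) (hb : Function.Bijective (Sum.elim E O))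
    (hE : ∀ i j, v (E i) (E j) = 0) (hO : ∀ i j, v (O i) (O j) = 0)
    (hC : ∀ i j, v (O j) (E i) = - v (E (i + 2)) (O (j + 2)))
    (hz : (∀ j, v (E 0) (O j) = 0) ∨
      (v (E 0) (O 0) = 0 ∧ v (E 0) (O 1) = 0 ∧ v (E 1) (O 0) = 0 ∧ v (E 1) (O 1) = 0))
    (g : Polynomial k) (hmonic : g.Monic)
    (hchar : v.charpoly = g.comp (Polynomial.X ^ 2)) :
    ∃ r : AlgebraicClosure k,
      2 ≤ (g.map (algebraMap k (AlgebraicClosure k))).rootMultiplicity r := by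
  set B : Matrix (Fin 4) (Fin 4) k := v.submatrix E O with hB
  set D : Matrix (Fin 4) (Fin 4) k := v.submatrix O E with hD
  have hv : v.charpoly = (fromBlocks 0 B D 0).charpoly := by
    have hm : Matrix.reindex (Equiv.ofBijective _ hb).symm (Equiv.ofBijective _ hb).symm v =
        fromBlocks 0 B D 0 := by
      ext (i | i) (j | j) <;> simp [hE, hO, hB, hD]
    rw [← Matrix.charpoly_reindex (Equiv.ofBijective _ hb).symm v, hm]
  have hg : g = (B * D).charpoly := by
    rw [hv, aux_charpoly] at hchar
    rw [← Polynomial.expand_eq_comp_X_pow, ← Polynomial.expand_eq_comp_X_pow] at hchar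
    exact (Polynomial.expand_injective (by norm_num) hchar).symm
  have hDB : ∀ i j, D j i = - B (i + 2) (j + 2) := fun i j => hC i j
  rcases hz with hz | ⟨h00, h01, h10, h11⟩
  · have hz' : ∀ j, B 0 j = 0 := hz
    refine aux_root g X (by simp) hmonic.ne_zero ?_
    rw [hg]
    refine aux_sing _ (fun j => ?_) (fun i => ?_)
    · simp [Matrix.mul_apply, hz']
    · rw [Matrix.mul_apply]
      refine Finset.sum_eq_zero fun j _ => ?_
      rw [hDB, show (2 : Fin 4) + 2 = 0 from rfl, hz']; simp
  · have b00 : B 0 0 = 0 := h00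
    have b01 : B 0 1 = 0 := h01
    have b10 : B 1 0 = 0 := h10
    have b11 : B 1 1 = 0 := h11
    have e2 : (2 : Fin 4) + 2 = 0 := rfl
    have e3 : (3 : Fin 4) + 2 = 1 := rfl
    have e1 : (1 : Fin 4) + 2 = 3 := rfl
    refine aux_root g ((X - Polynomial.C ((B * D) 0 0)) * (X - Polynomial.C ((B * D) 1 1))
      - Polynomial.C ((B * D) 0 1) * Polynomial.C ((B * D) 1 0)) ?_ hmonic.ne_zero ?_
    · have : ((X - Polynomial.C ((B * D) 0 0)) * (X - Polynomial.C ((B * D) 1 1))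
      - Polynomial.C ((B * D) 0 1) * Polynomial.C ((B * D) 1 0)).degree = 2 := by
        compute_degree!
      rw [this]; norm_num
    · rw [hg, aux_sq (B * D)] <;>
      simp [Matrix.mul_apply, Fin.sum_univ_four, hDB, b00, b01, b10, b11, e1, e2, e3] <;> ring

def r0 : Fin 8 → Bool := ![true, false, false, false, true, false, false, false]
def r1 : Fin 8 → Bool := ![true, false, false, false, false, false, false, true]
def c0 : Fin 8 → Bool := ![false, false, true, false, false, false, true, false]
def c1 : Fin 8 → Bool := ![false, false, true, false, false, true, false, false]

lemma aux_wt {k : Type*} [Field k] (h2 : (2 : k) ≠ 0) (h3 : (3 : k) ≠ 0) (ε : Fin 4 → Bool)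
    (w : Matrix (Fin 8) (Fin 8) k) (hw : w ∈ Veps k ε) (p q : Fin 8)
    (hp : p = 0 ∨ p = 3 ∨ p = 4 ∨ p = 7) (hq : q = 1 ∨ q = 2 ∨ q = 5 ∨ q = 6)
    (hne : w p q ≠ 0) : ε = ![r0 p, r1 p, c0 q, c1 q] := by
  have key : ∀ a b c d : k, a ≠ 0 → b ≠ 0 → c ≠ 0 → d ≠ 0 →
      (![a, b, b⁻¹, a⁻¹, c, d, d⁻¹, c⁻¹] : Fin 8 → k) p *
      (![a⁻¹, b⁻¹, b, a, c⁻¹, d⁻¹, d, c] : Fin 8 → k) q = chi k ε a b c d := by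
    intro a b c d ha hb hc hd
    have := congrFun (congrFun (hw.2 a b c d ha hb hc hd) p) q
    simp only [Dm, Matrix.mul_diagonal, Matrix.diagonal_mul, Matrix.smul_apply, smul_eq_mul,
      inv_inv] at this
    refine mul_right_cancel₀ hne ?_
    rw [← this]; ring
  have n1 : (2 : k) ≠ 1 := fun h => one_ne_zero (α := k) (by linear_combination h)
  have n2 : (2 : k)⁻¹ ≠ 1 := fun h => n1 (by rw [← inv_inv (2 : k), h, inv_one])
  have n3 : (2 : k) ≠ (2 : k)⁻¹ := fun h => h3 (by
    have : (2 : k) * 2 = 1 := by nth_rewrite 2 [h]; exact mul_inv_cancel₀ h2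
    linear_combination this)
  have o := one_ne_zero (α := k)
  have ka := key 2 1 1 1 h2 o o o
  have kb := key 1 2 1 1 o h2 o o
  have kc := key 1 1 2 1 o o h2 o
  have kd := key 1 1 1 2 o o o h2
  clear key
  have E01 : ε 0 = r0 p ∧ ε 1 = r1 p := by
    clear kb kd
    have hq1 : (![(2:k)⁻¹, 1⁻¹, 1, 2, 1⁻¹, 1⁻¹, 1, 1] : Fin 8 → k) q = 1 := by
      rcases hq with rfl | rfl | rfl | rfl <;> simp
    have hq2 : (![(1:k)⁻¹, 1⁻¹, 1, 1, 2⁻¹, 1⁻¹, 1, 2] : Fin 8 → k) q = 1 := by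
      rcases hq with rfl | rfl | rfl | rfl <;> simp
    rw [hq1] at ka
    rw [hq2] at kc
    rcases hp with rfl | rfl | rfl | rfl <;> cases h0 : ε 0 <;> cases h1 : ε 1 <;>
      simp [chi, h0, h1, r0, r1, n1, n2, n3, n1.symm, n2.symm, n3.symm] at ka kc ⊢
  have E23 : ε 2 = c0 q ∧ ε 3 = c1 q := by
    clear ka kc
    have hq1 : (![(1:k), 2, 2⁻¹, 1⁻¹, 1, 1, 1⁻¹, 1⁻¹] : Fin 8 → k) p = 1 := by
      rcases hp with rfl | rfl | rfl | rfl <;> simp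
    have hq2 : (![(1:k), 1, 1⁻¹, 1⁻¹, 1, 2, 2⁻¹, 1⁻¹] : Fin 8 → k) p = 1 := by
      rcases hp with rfl | rfl | rfl | rfl <;> simp
    rw [hq1] at kb
    rw [hq2] at kd
    rcases hq with rfl | rfl | rfl | rfl <;> cases h0 : ε 2 <;> cases h1 : ε 3 <;>
      simp [chi, h0, h1, c0, c1, n1, n2, n3, n1.symm, n2.symm, n3.symm] at kb kd ⊢
  ext x
  fin_cases x <;> simp [E01, E23]

def st : Fin 8 → Fin 8 := ![3, 2, 1, 0, 7, 6, 5, 4]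

lemma aux_st {k : Type*} [Field k] (v : Matrix (Fin 8) (Fin 8) k) (hv : v ∈ VSet k)
    (x y : Fin 8) : v (st y) x = - v (st x) y := by
  have := congrFun (congrFun hv.1 x) y
  have hP : ∀ i j, Psi k i j = if i = st j then 1 else 0 := by
    intro i j
    fin_cases i <;> fin_cases j <;> simp [Psi, st]
  have hP' : ∀ i j, Psi k i j = if st i = j then 1 else 0 := by
    intro i j
    fin_cases i <;> fin_cases j <;> simp [Psi, st]
  rw [Matrix.neg_apply, Matrix.mul_apply, Matrix.mul_apply] at this
  simp_rw [hP' x] at this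
  simp_rw [hP _ y] at this
  simpa using this

lemma aux_par {k : Type*} [Field k] (h2 : (2 : k) ≠ 0) (v : Matrix (Fin 8) (Fin 8) k)
    (hv : v ∈ VSet k) (x y : Fin 8)
    (h : (![1,-1,-1,1,1,-1,-1,1] : Fin 8 → k) x * (![1,-1,-1,1,1,-1,-1,1] : Fin 8 → k) y = 1) :
    v x y = 0 := by
  have := congrFun (congrFun hv.2 x) y
  simp only [sMat, Matrix.mul_diagonal, Matrix.diagonal_mul, Matrix.neg_apply] at this
  have h' : 2 * v x y = 0 := by linear_combination this - v x y * h
  simpa [h2] using h'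

/-- if `v ∈ V` has weight decomposition `v = Σ_ε v_ε` and there are two
indices `i < j` with `v_ε = 0` whenever `ε_i = ε_j = +1`, then the quartic `g_v`
(defined by `charpoly(v)(X) = g_v(X²)`) has a repeated root in an algebraic closure. -/
theorem stmt4 (k : Type*) [Field k] (h2 : ringChar k ≠ 2) (h3 : ringChar k ≠ 3)
    (v : Matrix (Fin 8) (Fin 8) k) (hv : v ∈ VSet k)
    (vc : (Fin 4 → Bool) → Matrix (Fin 8) (Fin 8) k)
    (hvc : ∀ ε, vc ε ∈ Veps k ε)
    (hsum : v = ∑ ε : Fin 4 → Bool, vc ε)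
    (i j : Fin 4) (hij : i < j)
    (hzero : ∀ ε : Fin 4 → Bool, ε i = true → ε j = true → vc ε = 0)
    (g : Polynomial k) (hmonic : g.Monic) (hdeg : g.natDegree = 4)
    (hchar : v.charpoly = g.comp (Polynomial.X ^ 2)) :
    ∃ r : AlgebraicClosure k,
      2 ≤ (g.map (algebraMap k (AlgebraicClosure k))).rootMultiplicity r := by
  have h2' : (2 : k) ≠ 0 := Ring.two_ne_zero h2
  have h3' : (3 : k) ≠ 0 := by
    intro h
    have hd : ringChar k ∣ 3 := (ringChar.spec k 3).mp (by exact_mod_cast h)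
    rcases (Nat.dvd_prime Nat.prime_three).mp hd with h1 | h1
    · exact CharP.ringChar_ne_one h1
    · exact h3 h1
  have hz : ∀ p q : Fin 8, (p = 0 ∨ p = 3 ∨ p = 4 ∨ p = 7) → (q = 1 ∨ q = 2 ∨ q = 5 ∨ q = 6) →
      (![r0 p, r1 p, c0 q, c1 q] : Fin 4 → Bool) i = true →
      (![r0 p, r1 p, c0 q, c1 q] : Fin 4 → Bool) j = true → v p q = 0 := by
    intro p q hp hq hi hj
    rw [hsum, Matrix.sum_apply]
    refine Finset.sum_eq_zero fun ε _ => ?_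
    by_contra hne
    have he := aux_wt h2' h3' ε _ (hvc ε) p q hp hq hne
    rw [← he] at hi hj
    exact hne (by rw [hzero ε hi hj]; rfl)
  have hst := aux_st v hv
  have hpar := aux_par h2' v hv
  clear hzero hsum hvc hv
  have main := fun E O hb hE hO hC hz => aux_main v E O hb hE hO hC hz g hmonic hchar
  have hEven : ∀ E : Fin 4 → Fin 8, (∀ i, E i = 0 ∨ E i = 3 ∨ E i = 4 ∨ E i = 7) →
      ∀ i j, v (E i) (E j) = 0 := by
    intro E hE i j
    refine hpar _ _ ?_
    rcases hE i with h | h | h | h <;> rcases hE j with h' | h' | h' | h' <;> simp [h, h']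
  have hOdd : ∀ E : Fin 4 → Fin 8, (∀ i, E i = 1 ∨ E i = 2 ∨ E i = 5 ∨ E i = 6) →
      ∀ i j, v (E i) (E j) = 0 := by
    intro E hE i j
    refine hpar _ _ ?_
    rcases hE i with h | h | h | h <;> rcases hE j with h' | h' | h' | h' <;> simp [h, h']
  have hrel : ∀ E O : Fin 4 → Fin 8, (∀ i, st (E (i + 2)) = E i) → (∀ i, st (O i) = O (i + 2)) →
      (∀ i, st (st (O i)) = O i) → ∀ i j, v (O j) (E i) = - v (E (i + 2)) (O (j + 2)) := by
    intro E O h1 h2 h3 i j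
    have h4 : ∀ i, st (E i) = E (i + 2) := by
      intro i
      have := h1 (i + 2)
      rwa [show i + 2 + 2 = i by rw [add_assoc]; exact add_zero i] at this
    have := hst (E i) (O (j + 2))
    rw [h4, ← h2, h3] at this
    rw [this, h2]
  fin_cases i <;> fin_cases j <;> first | exact absurd hij (by decide) | skip
  · refine main ![0, 4, 3, 7] ![2, 6, 1, 5] (by decide) (hEven _ (by decide)) (hOdd _ (by decide))
      (hrel _ _ (by decide) (by decide) (by decide)) (Or.inl ?_)
    intro j
    exact hz _ _ (by decide) (by revert j; decide) rfl rfl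
  · refine main ![0, 4, 3, 7] ![2, 6, 1, 5] (by decide) (hEven _ (by decide)) (hOdd _ (by decide))
      (hrel _ _ (by decide) (by decide) (by decide)) (Or.inr ?_)
    refine ⟨?_, ?_, ?_, ?_⟩ <;> exact hz _ _ (by decide) (by decide) rfl rfl
  · refine main ![0, 4, 3, 7] ![2, 5, 1, 6] (by decide) (hEven _ (by decide)) (hOdd _ (by decide))
      (hrel _ _ (by decide) (by decide) (by decide)) (Or.inr ?_)
    refine ⟨?_, ?_, ?_, ?_⟩ <;> exact hz _ _ (by decide) (by decide) rfl rfl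
  · refine main ![0, 7, 3, 4] ![2, 6, 1, 5] (by decide) (hEven _ (by decide)) (hOdd _ (by decide))
      (hrel _ _ (by decide) (by decide) (by decide)) (Or.inr ?_)
    refine ⟨?_, ?_, ?_, ?_⟩ <;> exact hz _ _ (by decide) (by decide) rfl rfl
  · refine main ![0, 7, 3, 4] ![2, 5, 1, 6] (by decide) (hEven _ (by decide)) (hOdd _ (by decide))
      (hrel _ _ (by decide) (by decide) (by decide)) (Or.inr ?_)
    refine ⟨?_, ?_, ?_, ?_⟩ <;> exact hz _ _ (by decide) (by decide) rfl rfl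
  · have hr := hrel ![1, 5, 2, 6] ![0, 4, 3, 7] (by decide) (by decide) (by decide)
    refine main ![1, 5, 2, 6] ![0, 4, 3, 7] (by decide) (hOdd _ (by decide)) (hEven _ (by decide))
      hr (Or.inl ?_)
    intro j
    have h5 := hr 2 (j + 2)
    rw [show j + 2 + 2 = j by rw [add_assoc]; exact add_zero j,
      show (2 : Fin 4) + 2 = 0 from rfl] at h5
    rw [← neg_eq_zero, ← h5]
    exact hz _ _ (by clear h5; revert j; decide) (by decide) rfl rfl

end
end

section
/- Let k be a field with char k ∉ {2,3}, let v ∈ V, and write v = Σ_ε v_ε with v_ε ∈ V_ε. Suppose that v_ε = 0 for every ε ∈ {±1}⁴ having at most one coordinate equal to −1 (that is, for ε = (1,1,1,1) and for the four tuples ε with exactly one entry −1). Then the quartic polynomial g_v has a repeated root in an algebraic closure of k (equivalently, the discriminant of g_v vanishes, i.e. Δ(v) = 0). -/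
open Matrix

noncomputable section

variable (k : Type*) [Field k]

theorem two_facts (k : Type*) [Field k] (h2 : ringChar k ≠ 2) (h3 : ringChar k ≠ 3) :
    (2 : k) ≠ 0 ∧ (3 : k) ≠ 0 := by
  constructor
  · intro h
    have h' : ((2 : ℕ) : k) = 0 := by exact_mod_cast h
    rw [ringChar.spec] at h'
    rcases (Nat.dvd_prime Nat.prime_two).1 h' with h1 | h1
    · exact CharP.ringChar_ne_one h1
    · exact h2 h1
  · intro h
    have h' : ((3 : ℕ) : k) = 0 := by exact_mod_cast h
    rw [ringChar.spec] at h'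
    rcases (Nat.dvd_prime Nat.prime_three).1 h' with h1 | h1
    · exact CharP.ringChar_ne_one h1
    · exact h3 h1

/-- The entry equation for a weight vector. -/
theorem weight_entry (k : Type*) [Field k] (ε : Fin 4 → Bool)
    (w : Matrix (Fin 8) (Fin 8) k) (hw : w ∈ Veps k ε) (a b c d : k)
    (ha : a ≠ 0) (hb : b ≠ 0) (hc : c ≠ 0) (hd : d ≠ 0) (i j : Fin 8) :
    (![a, b, b⁻¹, a⁻¹, c, d, d⁻¹, c⁻¹] : Fin 8 → k) i * w i j *
      (![a⁻¹, b⁻¹, b, a, c⁻¹, d⁻¹, d, c] : Fin 8 → k) j = chi k ε a b c d * w i j := by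
  have h := congrFun (congrFun (hw.2 a b c d ha hb hc hd) i) j
  simpa [Dm, Matrix.diagonal_mul, Matrix.mul_diagonal] using h

theorem mul_ne_zero_aux {k : Type*} [Field k] (p q m : k) (h : p * m = q * m) (hpq : p ≠ q) :
    m = 0 := by
  by_contra hm
  exact hpq (mul_right_cancel₀ hm h)

theorem entry_zero (k : Type*) [Field k] (h2 : (2 : k) ≠ 0) (h3 : (3 : k) ≠ 0)
    (ε : Fin 4 → Bool) (w : Matrix (Fin 8) (Fin 8) k) (hw : w ∈ Veps k ε)
    (hzero : (Finset.univ.filter fun i : Fin 4 => ε i = false).card ≤ 1 → w = 0) :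
    w 0 2 = 0 ∧ w 0 5 = 0 ∧ w 0 6 = 0 ∧ w 4 2 = 0 ∧ w 7 2 = 0 := by
  have n1 : (2 : k) ≠ 1 := fun h => one_ne_zero (α := k) (by linear_combination h)
  have n2 : (2 : k)⁻¹ ≠ 1 := fun h => n1 (by simpa using congrArg (·⁻¹) h)
  have n3 : (2 : k) ≠ 2⁻¹ := fun h => by
    have : (2 : k) * 2 = 1 := by nth_rewrite 2 [h]; exact mul_inv_cancel₀ h2
    exact h3 (by linear_combination this)
  have o : (1 : k) ≠ 0 := one_ne_zero
  have A := weight_entry k ε w hw 2 1 1 1 h2 o o o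
  have B := weight_entry k ε w hw 1 2 1 1 o h2 o o
  have C := weight_entry k ε w hw 1 1 2 1 o o h2 o
  have D := weight_entry k ε w hw 1 1 1 2 o o o h2
  have A2 := A 0 2
  have A5 := A 0 5
  have A6 := A 0 6
  have B0 := B 0 2
  have B4 := B 4 2
  have B7 := B 7 2
  have C4 := C 4 2
  have C7 := C 7 2
  have D5 := D 0 5
  have D6 := D 0 6
  clear A B C D hw
  by_cases hc : (Finset.univ.filter fun i : Fin 4 => ε i = false).card ≤ 1
  · have h := hzero hc
    subst h
    simp
  clear hzero
  rw [Finset.card_filter, Fin.sum_univ_four] at hc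
  rcases h0 : ε 0 <;> rcases h1 : ε 1 <;> rcases h2' : ε 2 <;> rcases h3' : ε 3 <;>
    first
    | (exfalso; simp [h0, h1, h2', h3'] at hc; done)
    | (clear hc
       simp [h0, h1, h2', h3', chi] at A2 A5 A6 B0 B4 B7 C4 C7 D5 D6
       clear h0 h1 h2' h3'
       refine ⟨?_, ?_, ?_, ?_, ?_⟩ <;> grind)

theorem div_aux {k : Type*} [Field k] (g : Polynomial k) (l : k)
    (h : (Polynomial.X ^ 2 - Polynomial.C l) ^ 2 ∣ g.comp (Polynomial.X ^ 2)) :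
    (Polynomial.X - Polynomial.C l) ^ 2 ∣ g := by
  set f : Polynomial k := (Polynomial.X - Polynomial.C l) ^ 2 with hf
  have hfm : f.Monic := (Polynomial.monic_X_sub_C l).pow 2
  have hfd : f.natDegree = 2 := by simp [hf]
  rw [← Polynomial.modByMonic_eq_zero_iff_dvd hfm]
  set r := g %ₘ f with hr
  have e : g = r + f * (g /ₘ f) := (Polynomial.modByMonic_add_div g f).symm
  have hfc : f.comp (Polynomial.X ^ 2) = (Polynomial.X ^ 2 - Polynomial.C l) ^ 2 := by
    simp [hf]
  have hd : f.comp (Polynomial.X ^ 2) ∣ r.comp (Polynomial.X ^ 2) := by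
    rw [← hfc, e, Polynomial.add_comp, Polynomial.mul_comp] at h
    exact (dvd_add_left (Dvd.intro _ rfl)).1 h
  have hlt : r.natDegree < 2 := by
    rw [← hfd]
    exact Polynomial.natDegree_modByMonic_lt g hfm (by intro h; rw [h] at hfd; simp at hfd)
  have h0 : r.comp (Polynomial.X ^ 2) = 0 := by
    apply Polynomial.eq_zero_of_dvd_of_natDegree_lt hd
    rw [Polynomial.natDegree_comp, Polynomial.natDegree_comp, hfd, Polynomial.natDegree_X_pow]
    omega
  rw [← Polynomial.expand_eq_comp_X_pow] at h0
  exact (Polynomial.expand_eq_zero (by norm_num)).1 h0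

def reorder : Fin 2 ⊕ (Fin 4 ⊕ Fin 2) ≃ Fin 8 where
  toFun := Sum.elim ![0, 1] (Sum.elim ![4, 5, 6, 7] ![2, 3])
  invFun := ![.inl 0, .inl 1, .inr (.inr 0), .inr (.inr 1),
    .inr (.inl 0), .inr (.inl 1), .inr (.inl 2), .inr (.inl 3)]
  left_inv := by decide
  right_inv := by decide

theorem det_aux {R : Type*} [CommRing R] (M : Matrix (Fin 8) (Fin 8) R)
    (h0 : ∀ j, j ≠ 0 → j ≠ 1 → M 0 j = 0) (h1 : ∀ j, j ≠ 0 → j ≠ 1 → M 1 j = 0)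
    (h2 : ∀ i, i ≠ 2 → i ≠ 3 → M i 2 = 0) (h3 : ∀ i, i ≠ 2 → i ≠ 3 → M i 3 = 0) :
    (M 0 0 * M 1 1 - M 0 1 * M 1 0) * (M 2 2 * M 3 3 - M 2 3 * M 3 2) ∣ M.det := by
  rw [← Matrix.det_submatrix_equiv_self reorder M,
    ← Matrix.fromBlocks_toBlocks (M.submatrix reorder reorder)]
  have z1 : (M.submatrix reorder reorder).toBlocks₁₂ = 0 := by
    ext i j
    fin_cases i
    · exact h0 _ (by revert j; decide) (by revert j; decide)
    · exact h1 _ (by revert j; decide) (by revert j; decide)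
  rw [z1, Matrix.det_fromBlocks_zero₁₂,
    ← Matrix.fromBlocks_toBlocks (M.submatrix reorder reorder).toBlocks₂₂]
  have z2 : (M.submatrix reorder reorder).toBlocks₂₂.toBlocks₁₂ = 0 := by
    ext i j
    fin_cases j
    · exact h2 _ (by revert i; decide) (by revert i; decide)
    · exact h3 _ (by revert i; decide) (by revert i; decide)
  rw [z2, Matrix.det_fromBlocks_zero₁₂]
  apply mul_dvd_mul
  · rw [Matrix.det_fin_two]; exact dvd_rfl
  · apply Dvd.intro_left
    rw [Matrix.det_fin_two (Matrix.toBlocks₂₂ _)]; rfl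

theorem so_entry (k : Type*) [Field k] (v : Matrix (Fin 8) (Fin 8) k) (hv : v ∈ VSet k)
    (i j : Fin 8) :
    v (![3, 2, 1, 0, 7, 6, 5, 4] j) i = - v (![3, 2, 1, 0, 7, 6, 5, 4] i) j := by
  have h := congrFun (congrFun hv.1 i) j
  simp only [Matrix.mul_apply, Fin.sum_univ_eight, Matrix.neg_apply, Matrix.transpose_apply] at h
  fin_cases i <;> fin_cases j <;> simpa [Psi] using h

theorem s_entry (k : Type*) [Field k] (h2 : (2 : k) ≠ 0)
    (v : Matrix (Fin 8) (Fin 8) k) (hv : v ∈ VSet k)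
    (i j : Fin 8) (hij : (![true, false, false, true, true, false, false, true] : Fin 8 → Bool) i
      = (![true, false, false, true, true, false, false, true] : Fin 8 → Bool) j) :
    v i j = 0 := by
  have h := congrFun (congrFun hv.2 i) j
  simp only [sMat, Matrix.diagonal_mul, Matrix.mul_diagonal, Matrix.neg_apply] at h
  have : v i j = - v i j := by
    fin_cases i <;> fin_cases j <;> first | (exfalso; revert hij; decide) | simpa using h
  have h' : 2 * v i j = 0 := by linear_combination this
  exact (mul_eq_zero.1 h').resolve_left h2

/-- if `v ∈ V` has weight decomposition `v = Σ_ε v_ε` and `v_ε = 0` for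
every `ε ∈ {±1}⁴` having at most one coordinate equal to `−1`, then the quartic `g_v`
(defined by `charpoly(v)(X) = g_v(X²)`) has a repeated root in an algebraic closure. -/
theorem stmt5 (k : Type*) [Field k] (h2 : ringChar k ≠ 2) (h3 : ringChar k ≠ 3)
    (v : Matrix (Fin 8) (Fin 8) k) (hv : v ∈ VSet k)
    (vc : (Fin 4 → Bool) → Matrix (Fin 8) (Fin 8) k)
    (hvc : ∀ ε, vc ε ∈ Veps k ε)
    (hsum : v = ∑ ε : Fin 4 → Bool, vc ε)
    (hzero : ∀ ε : Fin 4 → Bool,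
      (Finset.univ.filter fun i : Fin 4 => ε i = false).card ≤ 1 → vc ε = 0)
    (g : Polynomial k) (hmonic : g.Monic) (hdeg : g.natDegree = 4)
    (hchar : v.charpoly = g.comp (Polynomial.X ^ 2)) :
    ∃ r : AlgebraicClosure k,
      2 ≤ (g.map (algebraMap k (AlgebraicClosure k))).rootMultiplicity r := by
  obtain ⟨c2, c3⟩ := two_facts k h2 h3
  have key := fun ε => entry_zero k c2 c3 ε (vc ε) (hvc ε) (hzero ε)
  have z02 : v 0 2 = 0 := by
    rw [hsum, Matrix.sum_apply]; exact Finset.sum_eq_zero fun ε _ => (key ε).1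
  have z05 : v 0 5 = 0 := by
    rw [hsum, Matrix.sum_apply]; exact Finset.sum_eq_zero fun ε _ => (key ε).2.1
  have z06 : v 0 6 = 0 := by
    rw [hsum, Matrix.sum_apply]; exact Finset.sum_eq_zero fun ε _ => (key ε).2.2.1
  have z42 : v 4 2 = 0 := by
    rw [hsum, Matrix.sum_apply]; exact Finset.sum_eq_zero fun ε _ => (key ε).2.2.2.1
  have z72 : v 7 2 = 0 := by
    rw [hsum, Matrix.sum_apply]; exact Finset.sum_eq_zero fun ε _ => (key ε).2.2.2.2
  have S := s_entry k c2 v hv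
  have E := so_entry k v hv
  have z13 : v 1 3 = 0 := by simpa [z02] using E 3 2
  have z14 : v 1 4 = 0 := by simpa [z72] using E 4 2
  have z17 : v 1 7 = 0 := by simpa [z42] using E 7 2
  have z53 : v 5 3 = 0 := by simpa [z06] using E 3 6
  have z63 : v 6 3 = 0 := by simpa [z05] using E 3 5
  have e23 : v 2 3 = - v 0 1 := by simpa using E 3 1
  have e32 : v 3 2 = - v 1 0 := by simpa using E 2 0
  have hd : (Polynomial.X ^ 2 - Polynomial.C (v 0 1 * v 1 0)) ^ 2 ∣ v.charpoly := by
    have h := det_aux v.charmatrix ?_ ?_ ?_ ?_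
    · have s0 := S 0 0 rfl
      have s1 := S 1 1 rfl
      have s2 := S 2 2 rfl
      have s3 := S 3 3 rfl
      simp [Matrix.charmatrix_apply, s0, s1, s2, s3, e23, e32] at h
      rw [Matrix.charpoly]
      convert h using 1
      simp
      ring
    · intro j j0 j1
      rw [Matrix.charmatrix_apply_ne _ _ _ (Ne.symm j0)]
      fin_cases j <;> first | exact absurd rfl j0 | exact absurd rfl j1 | simp [z02, z05, z06] | simp [S _ _ rfl]
      all_goals exact S _ _ rfl
    · intro j j0 j1
      rw [Matrix.charmatrix_apply_ne _ _ _ (Ne.symm j1)]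
      fin_cases j <;> first | exact absurd rfl j0 | exact absurd rfl j1 | simp [z13, z14, z17]
      all_goals exact S _ _ rfl
    · intro j j0 j1
      rw [Matrix.charmatrix_apply_ne _ _ _ j0]
      fin_cases j <;> first | exact absurd rfl j0 | exact absurd rfl j1 | simp [z02, z42, z72]
      all_goals exact S _ _ rfl
    · intro j j0 j1
      rw [Matrix.charmatrix_apply_ne _ _ _ j1]
      fin_cases j <;> first | exact absurd rfl j0 | exact absurd rfl j1 | simp [z13, z53, z63]
      all_goals exact S _ _ rfl
  rw [hchar] at hd
  have hg := div_aux g _ hd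
  refine ⟨algebraMap k (AlgebraicClosure k) (v 0 1 * v 1 0), ?_⟩
  rw [Polynomial.le_rootMultiplicity_iff (hmonic.map _).ne_zero]
  have := Polynomial.map_dvd (algebraMap k (AlgebraicClosure k)) hg
  simpa using this


end
end
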